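/- Let 𝔄 be a unital C*-algebra and let A ∈ 𝔄 be nonzero. Then there exists a pure state ω on 𝔄 with ω(A* A) = ‖A‖². -/

import Mathlib

open scoped ComplexOrder

/-- A state on a unital C*-algebra: a linear functional that is positive
(`ω(a*a) ≥ 0`) and normalised (`ω(1) = 1`). -/
def IsState {A : Type*} [Ring A] [Algebra ℂ A] [Star A] (ω : A → ℂ) : Prop :=
  (∀ x y : A, ω (x + y) = ω x + ω y) ∧
  (∀ (c : ℂ) (x : A), ω (c • x) = c * ω x) ∧
  (∀ x : A, 0 ≤ ω (star x * x)) ∧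
  ω 1 = 1

/-- A state is pure if any decomposition of it as a convex combination
`λω₁ + (1−λ)ω₂` of states with `λ ∈ (0,1)` forces `ω₁ = ω₂`. -/
def IsPureState {A : Type*} [Ring A] [Algebra ℂ A] [Star A] (ω : A → ℂ) : Prop :=
  IsState ω ∧
    ∀ ω₁ ω₂ : A → ℂ, IsState ω₁ → IsState ω₂ →
      ∀ l : ℝ, l ∈ Set.Ioo (0 : ℝ) 1 →
        (∀ a : A, ω a = (l : ℂ) * ω₁ a + (1 - (l : ℂ)) * ω₂ a) → ω₁ = ω₂

section StateSpace

variable {A : Type*} [CStarAlgebra A]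

namespace IsState

variable {ω : A → ℂ}

theorem map_add (h : IsState ω) (x y : A) : ω (x + y) = ω x + ω y := h.1 x y

theorem map_smul (h : IsState ω) (c : ℂ) (x : A) : ω (c • x) = c * ω x := h.2.1 c x

theorem map_star_mul_self_nonneg (h : IsState ω) (x : A) : 0 ≤ ω (star x * x) := h.2.2.1 x

theorem map_one (h : IsState ω) : ω 1 = 1 := h.2.2.2

theorem map_algebraMap (h : IsState ω) (r : ℝ) : ω (algebraMap ℝ A r) = r := by
  rw [IsScalarTower.algebraMap_apply ℝ ℂ A, Algebra.algebraMap_eq_smul_one, h.map_smul, h.map_one,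
    mul_one]
  rfl

theorem map_sub (h : IsState ω) (x y : A) : ω (x - y) = ω x - ω y := by
  rw [eq_sub_iff_add_eq, ← h.map_add, sub_add_cancel]

variable [PartialOrder A] [StarOrderedRing A]

theorem map_nonneg (h : IsState ω) {x : A} (hx : 0 ≤ x) : 0 ≤ ω x := by
  obtain ⟨y, rfl⟩ := CStarAlgebra.nonneg_iff_eq_star_mul_self.mp hx
  exact h.map_star_mul_self_nonneg y

theorem map_mono (h : IsState ω) {x y : A} (hxy : x ≤ y) : ω x ≤ ω y := by
  simpa [h.map_sub] using h.map_nonneg (sub_nonneg.mpr hxy)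

theorem re_apply_le_norm (h : IsState ω) {x : A} (hx : IsSelfAdjoint x) : (ω x).re ≤ ‖x‖ := by
  have := h.map_mono hx.le_algebraMap_norm_self
  rw [h.map_algebraMap] at this
  exact this.1

theorem norm_apply_le_of_isSelfAdjoint (h : IsState ω) {x : A} (hx : IsSelfAdjoint x) :
    ‖ω x‖ ≤ ‖x‖ := by
  have h₁ := h.map_mono hx.le_algebraMap_norm_self
  have h₂ := h.map_mono hx.neg_algebraMap_norm_le_self
  rw [← _root_.map_neg, h.map_algebraMap] at h₂
  rw [h.map_algebraMap] at h₁
  have him : (ω x).im = 0 := h₁.2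
  rw [← Complex.re_add_im (ω x), him]
  simpa [abs_le] using And.intro h₂.1 h₁.1

theorem norm_apply_le (h : IsState ω) (x : A) : ‖ω x‖ ≤ 2 * ‖x‖ := by
  nth_rewrite 1 [← realPart_add_I_smul_imaginaryPart x]
  rw [h.map_add, h.map_smul]
  have h₁ := h.norm_apply_le_of_isSelfAdjoint (realPart x).2
  have h₂ := h.norm_apply_le_of_isSelfAdjoint (imaginaryPart x).2
  have h₃ : ‖(realPart x : A)‖ ≤ ‖x‖ := realPart.norm_le x
  have h₄ : ‖(imaginaryPart x : A)‖ ≤ ‖x‖ := imaginaryPart.norm_le x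
  calc _ ≤ _ := norm_add_le _ _
    _ ≤ 2 * ‖x‖ := by rw [norm_mul, Complex.norm_I]; linarith

end IsState

theorem isClosed_ofPred_isState : IsClosed {ω : A → ℂ | IsState ω} := by
  simp only [IsState, Set.ofPred_and, Set.ofPred_forall]
  refine .inter ?_ (.inter ?_ (.inter ?_ ?_))
  · exact isClosed_iInter fun x => isClosed_iInter fun y => isClosed_eq (by fun_prop) (by fun_prop)
  · exact isClosed_iInter fun c => isClosed_iInter fun x => isClosed_eq (by fun_prop) (by fun_prop)
  · exact isClosed_iInter fun x => isClosed_le (by fun_prop) (by fun_prop)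
  · exact isClosed_eq (by fun_prop) (by fun_prop)

/-- A contractive functional on a C⋆-algebra that maps `1` to `1` takes real values on
self-adjoint elements. -/
theorem im_apply_eq_zero_of_norm_le_one {f : StrongDual ℂ A} (hf : ‖f‖ ≤ 1) (h1 : f 1 = 1)
    {x : A} (hx : IsSelfAdjoint x) : (f x).im = 0 := by
  have key (t : ℝ) : ((f x).im + t) ^ 2 ≤ ‖x‖ ^ 2 + t ^ 2 := by
    have : Nontrivial A := ⟨1, 0, fun h => by simp [h] at h1⟩
    set z : A := x + (Complex.I * t) • (1 : A) with hz
    have hfz : f z = f x + Complex.I * t := by simp [hz, h1]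
    have hzz : star z * z = x * x + ((t : ℂ) ^ 2) • (1 : A) := by
      have hc : star (Complex.I * t) = -(Complex.I * t) := by simp
      have ht : (t : ℂ) ^ 2 = -(Complex.I * t) * (Complex.I * t) := by
        linear_combination (t : ℂ) ^ 2 * Complex.I_mul_I
      simp only [hz, star_add, hx.star_eq, star_smul, star_one, add_mul, mul_add, mul_smul_comm,
        smul_mul_assoc, mul_one, one_mul, hc, ht]
      module
    have h₁ : ‖z‖ ^ 2 ≤ ‖x‖ ^ 2 + t ^ 2 := by
      rw [sq, ← CStarRing.norm_star_mul_self, hzz]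
      refine (norm_add_le _ _).trans (add_le_add ((norm_mul_le _ _).trans_eq (sq _).symm) ?_)
      simp [norm_smul]
    have h₂ : ‖f z‖ ≤ ‖z‖ := by simpa using f.le_of_opNorm_le hf z
    have h₃ : |(f z).im| ≤ ‖f z‖ := Complex.abs_im_le_norm _
    have h₄ : (f z).im = (f x).im + t := by simp [hfz]
    rw [← h₄]
    exact (sq_le_sq' (abs_le.mp (h₃.trans h₂)).1 (abs_le.mp (h₃.trans h₂)).2).trans h₁
  by_contra hne
  have := key ((‖x‖ ^ 2 + 1) / (2 * (f x).im))
  have h2 : 2 * (f x).im * ((‖x‖ ^ 2 + 1) / (2 * (f x).im)) = ‖x‖ ^ 2 + 1 := by field_simp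
  nlinarith [sq_nonneg (f x).im]

variable [PartialOrder A] [StarOrderedRing A]

theorem isCompact_ofPred_isState : IsCompact {ω : A → ℂ | IsState ω} := by
  refine (isCompact_univ_pi fun x : A => isCompact_closedBall (0 : ℂ) (2 * ‖x‖)).of_isClosed_subset
    isClosed_ofPred_isState fun ω hω x _ => ?_
  simpa using IsState.norm_apply_le hω x

/-- A contractive functional on a C⋆-algebra that maps `1` to `1` is a state. -/
theorem isState_of_norm_le_one {f : StrongDual ℂ A} (hf : ‖f‖ ≤ 1) (h1 : f 1 = 1) :
    IsState (f : A → ℂ) := by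
  refine ⟨_root_.map_add f, fun c x => by simp, fun x => ?_, h1⟩
  have hx : 0 ≤ star x * x := star_mul_self_nonneg x
  set p := star x * x
  have hp : IsSelfAdjoint p := hx.isSelfAdjoint
  refine Complex.le_def.mpr ⟨?_, (im_apply_eq_zero_of_norm_le_one hf h1 hp).symm⟩
  set q : A := algebraMap ℝ A ‖p‖ - p with hq
  have hfq : f q = ‖p‖ - f p := by
    rw [hq, _root_.map_sub, IsScalarTower.algebraMap_apply ℝ ℂ A, Algebra.algebraMap_eq_smul_one,
      _root_.map_smul, h1]
    simp
  have hq0 : 0 ≤ q := sub_nonneg.mpr hp.le_algebraMap_norm_self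
  have hqn : ‖q‖ ≤ ‖p‖ :=
    (CStarAlgebra.norm_le_iff_le_algebraMap q (norm_nonneg p) hq0).mpr (sub_le_self _ hx)
  have h₂ : ‖f q‖ ≤ ‖q‖ := by simpa using f.le_of_opNorm_le hf q
  have h₃ := (Complex.re_le_norm _).trans (h₂.trans hqn)
  rw [hfq] at h₃
  simpa using h₃

theorem CStarAlgebra.norm_one_add_of_nonneg [Nontrivial A] {b : A} (hb : 0 ≤ b) :
    ‖1 + b‖ = 1 + ‖b‖ := by
  refine le_antisymm ((norm_add_le _ _).trans_eq (by simp)) ?_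
  have h := spectrum.add_mem_add_iff (s := (1 : ℝ)).mpr
    (CStarAlgebra.norm_mem_spectrum_of_nonneg hb)
  have := spectrum.norm_le_norm_of_mem h
  rw [_root_.map_one, Real.norm_of_nonneg (by positivity)] at this
  rwa [add_comm 1 ‖b‖]

theorem exists_isState_apply_eq_norm [Nontrivial A] {b : A} (hb : 0 ≤ b) :
    ∃ ω : A → ℂ, IsState ω ∧ ω b = ‖b‖ := by
  obtain ⟨f, hf, hfb⟩ := exists_dual_vector'' ℂ (1 + b)
  rw [CStarAlgebra.norm_one_add_of_nonneg hb, _root_.map_add] at hfb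
  have h₁ : ‖f 1‖ ≤ 1 := by simpa using f.le_of_opNorm_le hf 1
  have h₂ : ‖f b‖ ≤ ‖b‖ := by simpa using f.le_of_opNorm_le hf b
  have hre : (f 1).re + (f b).re = 1 + ‖b‖ := by simpa using congrArg Complex.re hfb
  have h₃ : (f 1).re = ‖f 1‖ := by
    linarith [Complex.re_le_norm (f 1), Complex.re_le_norm (f b)]
  have h₄ : ‖f 1‖ = 1 := by linarith [Complex.re_le_norm (f 1), Complex.re_le_norm (f b)]
  have h1 : f 1 = 1 := by
    have := Complex.re_eq_norm.mp h₃
    rw [Complex.eq_re_of_ofReal_le this, h₃, h₄, Complex.ofReal_one]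
  refine ⟨f, isState_of_norm_le_one hf h1, ?_⟩
  rw [h1] at hfb
  simpa using hfb

theorem exists_isPureState_apply_eq_norm [Nontrivial A] {b : A} (hb : 0 ≤ b) :
    ∃ ω : A → ℂ, IsPureState ω ∧ ω b = ‖b‖ := by
  set F : Set (A → ℂ) := {ω | IsState ω} ∩ {ω | ω b = ‖b‖}
  have hF : IsCompact F :=
    isCompact_ofPred_isState.inter_right (isClosed_eq (by fun_prop) (by fun_prop))
  obtain ⟨ω, hω⟩ := hF.extremePoints_nonempty (exists_isState_apply_eq_norm hb)
  obtain ⟨⟨hs, hωb⟩, hext⟩ := mem_extremePoints.mp hω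
  refine ⟨ω, ⟨hs, fun ω₁ ω₂ hs₁ hs₂ l hl hconv => ?_⟩, hωb⟩
  have hsa : IsSelfAdjoint b := hb.isSelfAdjoint
  have hre : ‖b‖ = l * (ω₁ b).re + (1 - l) * (ω₂ b).re := by
    have := congrArg Complex.re (hconv b)
    rw [hωb] at this
    simpa using this
  have h₁ := hs₁.re_apply_le_norm hsa
  have h₂ := hs₂.re_apply_le_norm hsa
  have apply_eq {φ : A → ℂ} (hφ : IsState φ) (h : ‖b‖ ≤ (φ b).re) : φ b = ‖b‖ :=
    Complex.ext (by simpa using le_antisymm (hφ.re_apply_le_norm hsa) h)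
      (by simpa using (hφ.map_nonneg hb).2.symm)
  have hb₁ : ω₁ b = ‖b‖ := apply_eq hs₁ <| by
    by_contra! hlt
    nlinarith [mul_lt_mul_of_pos_left hlt hl.1, mul_le_mul_of_nonneg_left h₂ (sub_pos.2 hl.2).le]
  have hb₂ : ω₂ b = ‖b‖ := apply_eq hs₂ <| by
    by_contra! hlt
    nlinarith [mul_le_mul_of_nonneg_left h₁ hl.1.le, mul_lt_mul_of_pos_left hlt (sub_pos.2 hl.2)]
  have hseg : ω ∈ openSegment ℝ ω₁ ω₂ :=
    ⟨l, 1 - l, hl.1, sub_pos.2 hl.2, by ring, funext fun x => by simp [hconv x]⟩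
  obtain ⟨e₁, e₂⟩ := hext ω₁ ⟨hs₁, hb₁⟩ ω₂ ⟨hs₂, hb₂⟩ hseg
  exact e₁.trans e₂.symm

end StateSpace

/-- For every nonzero element `a` of a unital C*-algebra there exists a pure
state `ω` with `ω(a*a) = ‖a‖²`. -/
theorem exists_pure_state_norm_attained {A : Type*} [NormedRing A] [StarRing A]
    [CStarRing A] [NormedAlgebra ℂ A] [StarModule ℂ A] [CompleteSpace A]
    (a : A) (ha : a ≠ 0) :
    ∃ ω : A → ℂ, IsPureState ω ∧ ω (star a * a) = ((‖a‖ ^ 2 : ℝ) : ℂ) := by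
  let _ : CStarAlgebra A := { }
  let _ : PartialOrder A := CStarAlgebra.spectralOrder A
  have : StarOrderedRing A := CStarAlgebra.spectralOrderedRing A
  have : Nontrivial A := ⟨a, 0, ha⟩
  obtain ⟨ω, hω, h⟩ := exists_isPureState_apply_eq_norm (star_mul_self_nonneg a)
  exact ⟨ω, hω, by rw [h, CStarRing.norm_star_mul_self, sq]⟩
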